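/- Let μ be an isotropic log-concave probability measure on ℝ^n with density f. Then for every convex body A ⊂ ℝ^n with A ⊆ R_{6n}(μ), one has μ⁺(∂A) ≤ 14 n^{3/2}, where R_{6n}(μ) = {x ∈ ℝ^n : f(x) ≥ e^{−6n}‖f‖_∞}. -/

import Mathlib

open MeasureTheory Metric Filter Set Pointwise

noncomputable section

abbrev Euc (n : ℕ) := EuclideanSpace ℝ (Fin n)

/-- `f` is a log-concave (nonnegative) function on `ℝ^n`. -/
def IsLogConcaveFn {n : ℕ} (f : Euc n → ℝ) : Prop :=
  (∀ x, 0 ≤ f x) ∧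
  ∀ x y : Euc n, ∀ τ : ℝ, 0 ≤ τ → τ ≤ 1 →
    f x ^ τ * f y ^ (1 - τ) ≤ f (τ • x + (1 - τ) • y)

/-- The `μ`-perimeter `μ⁺(∂A) = liminf_{ε→0⁺} μ((A + εB₂ⁿ) \ A) / ε`. -/
def muPerim {n : ℕ} (μ : Measure (Euc n)) (A : Set (Euc n)) : ℝ :=
  liminf (fun ε : ℝ => (μ ((A + closedBall (0 : Euc n) ε) \ A)).toReal / ε)
    (nhdsWithin 0 (Ioi 0))

/-- A convex body: compact convex set with nonempty interior. -/
def IsConvexBody {n : ℕ} (A : Set (Euc n)) : Prop :=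
  Convex ℝ A ∧ IsCompact A ∧ (interior A).Nonempty

/-- The super-level set `R_t(μ) = {x : f x ≥ e^{-t} ‖f‖_∞}` of a density `f`. -/
def superLevelSet {n : ℕ} (f : Euc n → ℝ) (t : ℝ) : Set (Euc n) :=
  {x | Real.exp (-t) * essSup f volume ≤ f x}

/-! ### Part 1: zonotopes and Minkowski sums -/

theorem seg_step {n : ℕ} (A R : Set (Euc n)) (hA : Convex ℝ A) (hR : Convex ℝ R) (v : Euc n) :
    volume (((A + segment ℝ 0 v) \ A) ∩ R) + volume R ≤ volume (R + segment ℝ 0 v) := by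
  set I := segment ℝ (0 : Euc n) v with hI
  have hIc : Convex ℝ I := convex_segment _ _
  have h0I : (0 : Euc n) ∈ I := left_mem_segment _ _ _
  have hRI : R ⊆ R + I := fun x hx => ⟨x, hx, 0, h0I, by simp⟩
  have nR : NullMeasurableSet R volume := hR.nullMeasurableSet volume
  have nA : NullMeasurableSet A volume := hA.nullMeasurableSet volume
  have nAI : NullMeasurableSet (A + I) volume := (hA.add hIc).nullMeasurableSet volume
  by_cases hfin : volume R = ⊤
  · have : volume (R + I) = ⊤ := top_le_iff.1 (hfin ▸ measure_mono hRI)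
    rw [this]; exact le_top
  set E := (A + I) \ A with hE
  have nE : NullMeasurableSet E volume := nAI.diff nA
  -- the key combinatorial fact
  have key : ∀ x ∈ E, ∀ j : ℕ, 1 ≤ j → x + (j : ℝ) • v ∉ E := by
    rintro x ⟨⟨a, ha, w, hw, rfl⟩, hxA⟩ j hj ⟨⟨a', ha', w', hw', h'⟩, hxA'⟩
    rw [hI, segment_eq_image] at hw hw'
    obtain ⟨t, ⟨ht0, ht1⟩, rfl⟩ := hw
    obtain ⟨t', ⟨ht0', ht1'⟩, rfl⟩ := hw'
    simp only [smul_zero, zero_add] at h' hxA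
    have hj' : (1 : ℝ) ≤ j := by exact_mod_cast hj
    apply hxA
    rcases eq_or_lt_of_le ht0 with h0 | h0
    · rw [← h0]; simpa using ha
    have hpos : 0 < t + j - t' := by linarith
    have ha'eq : a' = a + (t + j - t') • v := by
      have : a' = a + t • v + (j : ℝ) • v - t' • v := by rw [← h']; simp
      rw [this]; module
    have : a + t • v = ((j - t') / (t + j - t')) • a + (t / (t + j - t')) • a' := by
      rw [ha'eq]
      have h1 : (j - t') / (t + j - t') + (t / (t + j - t')) = 1 := by field_simp; ring
      have h2 : (t / (t + j - t')) * (t + j - t') = t := by field_simp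
      rw [smul_add, smul_smul, h2, ← add_assoc, ← add_smul, h1, one_smul]
    rw [this]
    refine hA ha ha' (div_nonneg (by linarith) hpos.le) (div_nonneg ht0 hpos.le) ?_
    field_simp; ring
  have tr : ∀ (S : Set (Euc n)) (u : Euc n), volume ((fun y => y - u) ⁻¹' S) = volume S := by
    intro S u; simp [sub_eq_add_neg]
  have ntr : ∀ (S : Set (Euc n)) (u : Euc n), NullMeasurableSet S volume →
      NullMeasurableSet ((fun y => y - u) ⁻¹' S) volume := by
    intro S u hS
    exact hS.preimage (measurePreserving_sub_right volume u).quasiMeasurePreserving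
  have ntr' : ∀ (S : Set (Euc n)) (u : Euc n), NullMeasurableSet S volume →
      NullMeasurableSet ((fun y => y + u) ⁻¹' S) volume := by
    intro S u hS
    exact hS.preimage (measurePreserving_add_right volume u).quasiMeasurePreserving
  -- disjointness of translates of subsets of E
  have disj : ∀ (S : ℕ → Set (Euc n)), (∀ m, S m ⊆ E) → ∀ c : ℕ,
      Pairwise (Function.onFun (AEDisjoint volume)
        (fun m : ℕ => (fun y => y - ((m + c : ℕ) : ℝ) • v) ⁻¹' (S m))) := by
    intro S hS c
    have aux : ∀ m m' : ℕ, m < m' → ∀ y, y - ((m + c : ℕ) : ℝ) • v ∈ S m →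
        y - ((m' + c : ℕ) : ℝ) • v ∈ S m' → False := by
      intro m m' hmm y h1 h2
      refine key _ (hS _ h2) (m' - m) (by omega) ?_
      have : y - ((m' + c : ℕ) : ℝ) • v + ((m' - m : ℕ) : ℝ) • v = y - ((m + c : ℕ) : ℝ) • v := by
        rw [Nat.cast_sub hmm.le]; push_cast; module
      rw [this]; exact hS _ h1
    intro m m' hmm
    apply Disjoint.aedisjoint
    rw [Set.disjoint_left]
    intro y h1 h2
    rcases lt_or_gt_of_ne hmm with h | h
    · exact aux m m' h y h1 h2
    · exact aux m' m h y h2 h1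
  set F := E ∩ ⋂ m : ℕ, (fun y => y + (m : ℝ) • v) ⁻¹' R with hF
  have nF : NullMeasurableSet F volume :=
    nE.inter (NullMeasurableSet.iInter fun m => ntr' _ _ nR)
  have hF0 : volume F = 0 := by
    by_contra hne
    have h1 : volume (⋃ m : ℕ, (fun y => y - ((m + 0 : ℕ) : ℝ) • v) ⁻¹' F) = ⊤ := by
      rw [measure_iUnion₀ (disj (fun _ => F) (fun _ => inter_subset_left) 0) (fun m => ntr _ _ nF)]
      simp only [tr]
      exact ENNReal.tsum_const_eq_top_of_ne_zero hne
    apply hfin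
    apply top_le_iff.1
    rw [← h1]
    apply measure_mono
    intro y hy
    obtain ⟨m, hm⟩ := mem_iUnion.1 hy
    have := (mem_iInter.1 hm.2 m)
    simpa using this
  set G : ℕ → Set (Euc n) := fun m =>
    E ∩ (((fun y => y + (m : ℝ) • v) ⁻¹' R) \ ((fun y => y + ((m + 1 : ℕ) : ℝ) • v) ⁻¹' R)) with hG
  have nG : ∀ m, NullMeasurableSet (G m) volume := fun m =>
    nE.inter ((ntr' _ _ nR).diff (ntr' _ _ nR))
  have cover : E ∩ R ⊆ F ∪ ⋃ m, G m := by
    rintro x ⟨hxE, hxR⟩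
    by_cases h : ∀ m : ℕ, x + (m : ℝ) • v ∈ R
    · left; exact ⟨hxE, mem_iInter.2 h⟩
    · right
      push Not at h
      classical
      have hp := Nat.find_spec h
      have hmin := fun k => @Nat.find_min _ _ h k
      rcases hk : Nat.find h with _ | k
      · rw [hk] at hp; simp at hp; exact absurd hxR hp
      · rw [hk] at hp
        have := hmin k (by omega)
        push Not at this
        exact mem_iUnion.2 ⟨k, hxE, this, hp⟩
  have hle : volume (E ∩ R) ≤ volume ((R + I) \ R) := by
    calc volume (E ∩ R) ≤ volume F + volume (⋃ m, G m) :=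
          (measure_mono cover).trans (measure_union_le _ _)
      _ ≤ ∑' m, volume (G m) := by rw [hF0, zero_add]; exact measure_iUnion_le _
      _ = ∑' m, volume ((fun y => y - ((m + 1 : ℕ) : ℝ) • v) ⁻¹' (G m)) := by simp only [tr]
      _ = volume (⋃ m : ℕ, (fun y => y - ((m + 1 : ℕ) : ℝ) • v) ⁻¹' (G m)) := by
          rw [measure_iUnion₀ (disj G (fun _ => inter_subset_left) 1) (fun m => ntr _ _ (nG m))]
      _ ≤ _ := by
          apply measure_mono
          intro y hy
          obtain ⟨m, -, h1, h2⟩ := mem_iUnion.1 hy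
          refine ⟨⟨_, h1, v, right_mem_segment _ _ _, ?_⟩, ?_⟩
          · push_cast; module
          · simpa using h2
  calc volume (E ∩ R) + volume R ≤ volume ((R + I) \ R) + volume R := by gcongr
    _ = volume (R + I) := by
      have := measure_inter_add_sdiff₀ (μ := volume) (R + I) nR
      rw [← this, inter_eq_self_of_subset_right hRI, add_comm]

theorem zono_step {n : ℕ} {ι : Type*} (s : Finset ι) (v : ι → Euc n) : ∀ (A R : Set (Euc n)),
    Convex ℝ A → Convex ℝ R →
    volume (((A + ∑ i ∈ s, segment ℝ 0 (v i)) \ A) ∩ R) + volume R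
      ≤ volume (R + ∑ i ∈ s, segment ℝ 0 (v i)) := by
  classical
  induction s using Finset.induction_on with
  | empty => intro A R hA hR; simp
  | insert i s hi ih =>
    intro A R hA hR
    rw [Finset.sum_insert hi]
    set I := segment ℝ (0 : Euc n) (v i)
    set Z := ∑ i ∈ s, segment ℝ (0 : Euc n) (v i)
    have hIc : Convex ℝ I := convex_segment _ _
    have h0I : (0 : Euc n) ∈ I := left_mem_segment _ _ _
    have h1 := seg_step A R hA hR (v i)
    have h2 := ih (A + I) (R + I) (hA.add hIc) (hR.add hIc)
    have hRI : R ⊆ R + I := fun x hx => ⟨x, hx, 0, h0I, by simp⟩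
    rw [← add_assoc, ← add_assoc]
    calc _ ≤ volume (((A + I + Z) \ (A + I)) ∩ (R + I)) + volume (((A + I) \ A) ∩ R)
          + volume R := by
          gcongr
          refine (measure_mono ?_).trans (measure_union_le _ _)
          rintro x ⟨⟨hx, hxA⟩, hxR⟩
          by_cases h : x ∈ A + I
          · right; exact ⟨⟨h, hxA⟩, hxR⟩
          · left; exact ⟨⟨hx, h⟩, hRI hxR⟩
      _ ≤ _ := by rw [add_assoc]; exact (by gcongr : _ ≤ _).trans h2
/-! ### Part 2: the perimeter bound from an inscribed ball -/

theorem cube_bounds {n : ℕ} (ε : ℝ) (hε : 0 < ε) :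
    ∃ (v : Fin n × Bool → Euc n),
      closedBall (0 : Euc n) ε ⊆ ∑ i, segment ℝ 0 (v i) ∧
      ∑ i, segment ℝ 0 (v i) ⊆ closedBall (0 : Euc n) (ε * Real.sqrt n) := by
  refine ⟨fun p => EuclideanSpace.single p.1 (if p.2 then ε else -ε), ?_, ?_⟩
  · intro x hx
    rw [mem_closedBall_zero_iff] at hx
    rw [Set.mem_fintype_sum]
    refine ⟨fun p => EuclideanSpace.single p.1 (if p.2 then max (x p.1) 0 else min (x p.1) 0),
      ?_, ?_⟩
    · rintro ⟨i, b⟩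
      have hxi : |x i| ≤ ε := (PiLp.norm_apply_le x i).trans hx
      rw [abs_le] at hxi
      rw [segment_eq_image]
      cases b
      · refine ⟨-(min (x i) 0) / ε, ⟨div_nonneg (by simp) hε.le, ?_⟩, ?_⟩
        · rw [div_le_one hε]
          have : -ε ≤ min (x i) 0 := le_min hxi.1 (by linarith)
          linarith
        · ext j
          by_cases hji : j = i
          · subst hji; simp; field_simp
          · simp [hji]
      · refine ⟨(max (x i) 0) / ε, ⟨div_nonneg (by simp) hε.le, ?_⟩, ?_⟩
        · rw [div_le_one hε]
          exact max_le hxi.2 hε.le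
        · ext j
          by_cases hji : j = i
          · subst hji; simp; field_simp
          · simp [hji]
    · ext j
      rw [Fintype.sum_prod_type]
      simp [Finset.sum_add_distrib, Pi.single_apply]
  · intro z hz
    rw [Set.mem_fintype_sum] at hz
    obtain ⟨g, hg, rfl⟩ := hz
    have hc : ∀ p, ∃ c : ℝ, 0 ≤ c ∧ c ≤ 1 ∧
        g p = EuclideanSpace.single p.1 (c * (if p.2 then ε else -ε)) := by
      intro p
      have := hg p
      rw [segment_eq_image] at this
      obtain ⟨c, ⟨h0, h1⟩, hc⟩ := this
      refine ⟨c, h0, h1, ?_⟩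
      rw [← hc]
      ext j
      simp
    choose c h0 h1 hgc using hc
    rw [mem_closedBall_zero_iff, EuclideanSpace.norm_eq]
    have hcoord : ∀ j : Fin n, ‖(∑ p, g p : Euc n) j‖ ≤ ε := by
      intro j
      have : (∑ p, g p : Euc n) j = c (j, true) * ε - c (j, false) * ε := by
        rw [Fintype.sum_prod_type]
        simp [hgc, Pi.single_apply, Finset.sum_add_distrib]
        ring
      rw [this, Real.norm_eq_abs, abs_le]
      constructor <;> nlinarith [h0 (j, true), h0 (j, false), h1 (j, true), h1 (j, false)]
    calc Real.sqrt (∑ j, ‖(∑ p, g p : Euc n) j‖ ^ 2) ≤ Real.sqrt (∑ j : Fin n, ε ^ 2) := by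
          apply Real.sqrt_le_sqrt
          apply Finset.sum_le_sum
          intro j _
          exact pow_le_pow_left₀ (norm_nonneg _) (hcoord j) 2
      _ = ε * Real.sqrt n := by
          simp only [Finset.sum_const, Finset.card_univ, Fintype.card_fin, nsmul_eq_mul]
          rw [mul_comm, Real.sqrt_mul (by positivity), Real.sqrt_sq hε.le]

theorem superlevel_convex {n : ℕ} {f : Euc n → ℝ} (hf : IsLogConcaveFn f) {s : ℝ} (hs : 0 ≤ s) :
    Convex ℝ {x | s < f x} := by
  intro x hx y hy a b ha hb hab
  have hb' : b = 1 - a := by linarith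
  subst hb'
  have h := hf.2 x y a ha (by linarith)
  refine lt_of_lt_of_le ?_ h
  simp only [mem_ofPred_eq] at hx hy
  have hm : s < min (f x) (f y) := lt_min hx hy
  have hm0 : 0 < min (f x) (f y) := lt_of_le_of_lt hs hm
  calc s < min (f x) (f y) := hm
    _ = min (f x) (f y) ^ a * min (f x) (f y) ^ (1 - a) := by
        rw [← Real.rpow_add hm0]; simp
    _ ≤ _ := by
        have h1 : min (f x) (f y) ≤ f x := min_le_left _ _
        have h2 : min (f x) (f y) ≤ f y := min_le_right _ _
        exact mul_le_mul (Real.rpow_le_rpow hm0.le h1 ha) (Real.rpow_le_rpow hm0.le h2 hb)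
          (Real.rpow_nonneg hm0.le _) (Real.rpow_nonneg (hf.1 _) _)

theorem eps_bound {n : ℕ} (f : Euc n → ℝ) (μ : Measure (Euc n))
    [IsProbabilityMeasure μ] (hfm : Measurable f)
    (hf : IsLogConcaveFn f)
    (hμ : μ = volume.withDensity (fun x => ENNReal.ofReal (f x)))
    (M k r : ℝ) (hM : ∀ x, f x ≤ M) (hk : 0 ≤ k) (hr : 0 < r)
    (hball : ∀ x, ‖x‖ ≤ r → Real.exp (-k) * M ≤ f x)
    (A : Set (Euc n)) (hA : Convex ℝ A) (hAm : MeasurableSet A) (ε : ℝ) (hε : 0 < ε)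
    (hn : 0 < n) :
    (μ ((A + closedBall (0 : Euc n) ε) \ A)).toReal + 1
      ≤ Real.exp (((n : ℝ) + k) * Real.sqrt n / r * ε) := by
  obtain ⟨v, hv1, hv2⟩ := cube_bounds (n := n) ε hε
  set Z := ∑ i, segment ℝ (0 : Euc n) (v i) with hZ
  have hn' : (0 : ℝ) < Real.sqrt n := Real.sqrt_pos.2 (by exact_mod_cast hn)
  set q := ε * Real.sqrt n / r with hq
  have hq0 : 0 < q := by positivity
  -- δ = q / (1 + q)
  have hbase : ∫⁻ x, ENNReal.ofReal (f x) = 1 := by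
    have : μ univ = 1 := measure_univ
    rw [hμ, withDensity_apply _ MeasurableSet.univ] at this
    simpa using this
  have hlc1 : ∫⁻ s in Ioi (0 : ℝ), volume {x | s < f x} = 1 := by
    rw [← hbase, lintegral_eq_lintegral_meas_lt volume (Eventually.of_forall hf.1)
      hfm.aemeasurable]
  have hZc : Convex ℝ Z := by
    rw [hZ]
    exact convex_sum _ (fun i _ => convex_segment _ _)
  set E := (A + Z) \ A with hE
  have nE : NullMeasurableSet E volume := by
    exact ((hA.add hZc).nullMeasurableSet volume).diff hAm.nullMeasurableSet
  have hlc2 : μ E = ∫⁻ s in Ioi (0 : ℝ), volume (E ∩ {x | s < f x}) := by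
    rw [hμ, withDensity_apply₀ _ nE, lintegral_eq_lintegral_meas_lt _ (Eventually.of_forall hf.1)
      hfm.aemeasurable]
    apply lintegral_congr
    intro s
    rw [Measure.restrict_apply (measurableSet_lt measurable_const hfm), inter_comm]
  set F : Euc n → ℝ := fun w => Real.exp (k * q) * f ((1 / (1 + q)) • w) with hF
  have hlc3 : ∫⁻ s in Ioi (0 : ℝ), volume {x | s < F x}
      = ENNReal.ofReal (Real.exp (k * q) * (1 + q) ^ n) := by
    rw [← lintegral_eq_lintegral_meas_lt volume
      (Eventually.of_forall fun w => mul_nonneg (Real.exp_pos _).le (hf.1 _))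
      (by apply Measurable.aemeasurable; fun_prop)]
    have e : ∀ w, ENNReal.ofReal (F w) = ENNReal.ofReal (Real.exp (k * q)) *
        ENNReal.ofReal (f ((1 / (1 + q)) • w)) := fun w => ENNReal.ofReal_mul (Real.exp_pos _).le
    refine (lintegral_congr e).trans ?_
    rw [ENNReal.ofReal_mul (Real.exp_pos (k * q)).le]
    rw [lintegral_const_mul _ (by fun_prop)]
    congr 1
    have hne : (1 / (1 + q)) ≠ 0 := by positivity
    have hmap := Measure.map_addHaar_smul (volume : Measure (Euc n)) hne
    have : ∫⁻ w, ENNReal.ofReal (f ((1 / (1 + q)) • w)) =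
        ∫⁻ y, ENNReal.ofReal (f y) ∂(Measure.map (fun w : Euc n => (1 / (1 + q)) • w) volume) := by
      rw [lintegral_map (by fun_prop) (by fun_prop)]
    rw [this]
    have hmap' : Measure.map (fun w : Euc n => (1 / (1 + q)) • w) volume = _ := hmap
    rw [hmap', lintegral_smul_measure, hbase]
    simp only [finrank_euclideanSpace, Fintype.card_fin, smul_eq_mul, mul_one]
    congr 1
    rw [abs_of_pos (by positivity)]
    simp
  have hincl : ∀ s ∈ Ioi (0 : ℝ), {x | s < f x} + Z ⊆ {x | s < F x} := by
    rintro s hs _ ⟨x, hx, z, hz, rfl⟩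
    have hs' : 0 < s := hs
    have hx' : s < f x := hx
    have hznorm : ‖z‖ ≤ ε * Real.sqrt n := by
      simpa using hv2 hz
    have hy : ‖(1 / q) • z‖ ≤ r := by
      rw [norm_smul, Real.norm_of_nonneg (by positivity)]
      calc 1 / q * ‖z‖ ≤ 1 / q * (ε * Real.sqrt n) := by gcongr
        _ = r := by rw [hq]; field_simp
    have h := hf.2 x ((1 / q) • z) (1 / (1 + q)) (by positivity)
      (by rw [div_le_one (by positivity)]; linarith)
    have heq : (1 / (1 + q)) • x + (1 - 1 / (1 + q)) • (1 / q) • z = (1 / (1 + q)) • (x + z) := by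
      rw [smul_smul, smul_add]
      congr 2
      field_simp
      ring
    rw [heq] at h
    have hb := hball _ hy
    have hd : 1 - 1 / (1 + q) = q / (1 + q) := by field_simp; ring
    have hsM : s ≤ M := hx'.le.trans (hM x)
    have h1 : s ^ (1 / (1 + q)) < f x ^ (1 / (1 + q)) :=
      Real.rpow_lt_rpow hs'.le hx' (by positivity)
    have h2 : (Real.exp (-k) * s) ^ (q / (1 + q)) ≤ f ((1 / q) • z) ^ (q / (1 + q)) := by
      apply Real.rpow_le_rpow (by positivity) _ (by positivity)
      refine le_trans ?_ hb
      gcongr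
    have h3 : s * Real.exp (-k * (q / (1 + q))) < f ((1 / (1 + q)) • (x + z)) := by
      refine lt_of_lt_of_le ?_ h
      rw [hd]
      calc s * Real.exp (-k * (q / (1 + q)))
          = s ^ (1 / (1 + q)) * (Real.exp (-k) * s) ^ (q / (1 + q)) := by
            rw [Real.mul_rpow (Real.exp_pos _).le hs'.le, ← Real.exp_mul]
            have : s = s ^ (1 / (1 + q)) * s ^ (q / (1 + q)) := by
              rw [← Real.rpow_add hs', ← hd]; simp
            nth_rewrite 1 [this]
            ring
        _ < _ := by
            apply mul_lt_mul h1 h2 (by positivity) (Real.rpow_nonneg (hf.1 _) _)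
    show s < Real.exp (k * q) * f ((1 / (1 + q)) • (x + z))
    have h4 : Real.exp (-(k * q)) ≤ Real.exp (-k * (q / (1 + q))) := by
      apply Real.exp_le_exp.2
      have : q / (1 + q) ≤ q := div_le_self hq0.le (by linarith)
      nlinarith
    have h5 : s * Real.exp (-(k * q)) < f ((1 / (1 + q)) • (x + z)) :=
      lt_of_le_of_lt (by gcongr) h3
    rw [Real.exp_neg, ← div_eq_mul_inv, div_lt_iff₀ (Real.exp_pos _)] at h5
    linarith
  have hmain : μ E + 1 ≤ ENNReal.ofReal (Real.exp (k * q) * (1 + q) ^ n) := by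
    rw [hlc2, ← hlc1, ← hlc3, ← lintegral_add_right']
    · apply lintegral_mono_ae
      filter_upwards [ae_restrict_mem measurableSet_Ioi] with s hs
      exact (zono_step Finset.univ v A _ hA (superlevel_convex hf (le_of_lt hs))).trans
        (measure_mono (hincl s hs))
    · apply Measurable.aemeasurable
      apply Antitone.measurable
      intro s t hst
      exact measure_mono fun x hx => lt_of_le_of_lt hst hx
  have hsub : (A + closedBall (0 : Euc n) ε) \ A ⊆ E :=
    sdiff_subset_sdiff_left (add_subset_add_left hv1)
  have hfinal : (μ E).toReal + 1 ≤ Real.exp (k * q) * (1 + q) ^ n := by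
    have := ENNReal.toReal_mono ENNReal.ofReal_ne_top hmain
    rw [ENNReal.toReal_add (measure_ne_top _ _) ENNReal.one_ne_top,
      ENNReal.toReal_ofReal (by positivity)] at this
    simpa using this
  calc _ ≤ (μ E).toReal + 1 := by
        gcongr
        exact measure_ne_top _ _
    _ ≤ Real.exp (k * q) * (1 + q) ^ n := hfinal
    _ ≤ Real.exp (k * q) * (Real.exp q) ^ n := by
        gcongr
        rw [add_comm]; exact Real.add_one_le_exp q
    _ = _ := by
        rw [← Real.exp_nat_mul, ← Real.exp_add]
        congr 1
        rw [hq]; ring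

theorem perim_of_ball {n : ℕ} (f : Euc n → ℝ) (μ : Measure (Euc n))
    [IsProbabilityMeasure μ] (hfm : Measurable f)
    (hf : IsLogConcaveFn f)
    (hμ : μ = volume.withDensity (fun x => ENNReal.ofReal (f x)))
    (M : ℝ) (hM : ∀ x, f x ≤ M)
    (hball : ∀ x, ‖x‖ ≤ 1 / 2 → Real.exp (-(6 * n)) * M ≤ f x)
    (A : Set (Euc n)) (hA : Convex ℝ A) (hAm : MeasurableSet A) (hn : 0 < n) :
    muPerim μ A ≤ 14 * (n : ℝ) ^ ((3 : ℝ) / 2) := by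
  set c : ℝ := ((n : ℝ) + 6 * n) * Real.sqrt n / (1 / 2) with hc
  have hc' : c = 14 * (n : ℝ) ^ ((3 : ℝ) / 2) := by
    have hn' : (0 : ℝ) < n := by exact_mod_cast hn
    rw [hc, Real.sqrt_eq_rpow, show (3 : ℝ) / 2 = 1 + 1 / 2 by norm_num, Real.rpow_add hn',
      Real.rpow_one]
    ring
  rw [← hc']
  have hlim : Tendsto (fun ε : ℝ => (Real.exp (c * ε) - 1) / ε) (nhdsWithin 0 (Ioi 0))
      (nhds c) := by
    have hd : HasDerivAt (fun ε : ℝ => Real.exp (c * ε)) c 0 := by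
      have := ((hasDerivAt_id (0 : ℝ)).const_mul c).exp
      simpa using this
    have := hd.tendsto_slope_zero_right
    simpa [div_eq_inv_mul] using this
  rw [← hlim.liminf_eq]
  unfold muPerim
  apply liminf_le_liminf
  · filter_upwards [self_mem_nhdsWithin] with ε hε
    have hε' : (0 : ℝ) < ε := hε
    have := eps_bound f μ hfm hf hμ M (6 * n) (1 / 2) hM (by positivity) (by norm_num) hball A hA
      hAm ε hε' hn
    rw [← hc] at this
    gcongr
    linarith
  · refine ⟨0, ?_⟩
    rw [eventually_map]
    filter_upwards [self_mem_nhdsWithin] with ε hε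
    have hε' : (0 : ℝ) < ε := hε
    positivity
  · exact hlim.isBoundedUnder_le.isCoboundedUnder_ge
/-! ### Part 3: the Prékopa-Leindler inequality -/

theorem bm_compact (K L : Set ℝ) (hK : IsCompact K) (hL : IsCompact L) (hK0 : K.Nonempty)
    (hL0 : L.Nonempty) : volume K + volume L ≤ volume (K + L) := by
  set a := sSup K
  set b := sInf L
  have ha : a ∈ K := hK.sSup_mem hK0
  have hb : b ∈ L := hL.sInf_mem hL0
  have h1 : volume ((fun x => x + b) '' K) = volume K := by simp
  have h2 : volume ((fun x => a + x) '' L) = volume L := by simp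
  rw [← h1, ← h2, ← measure_union₀]
  · apply measure_mono
    rintro x (⟨y, hy, rfl⟩ | ⟨y, hy, rfl⟩)
    · exact add_mem_add hy hb
    · exact add_mem_add ha hy
  · exact (hL.image (by fun_prop)).measurableSet.nullMeasurableSet
  · refine measure_mono_null (t := {a + b}) ?_ (by simp)
    rintro x ⟨⟨y, hy, rfl⟩, ⟨z, hz, hzy⟩⟩
    have h3 : y ≤ a := le_csSup hK.bddAbove hy
    have h4 : b ≤ z := csInf_le hL.bddBelow hz
    simp only [mem_singleton_iff] at *
    linarith

theorem bm_one (A B C : Set ℝ) (hA : MeasurableSet A) (hB : MeasurableSet B)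
    (hA0 : A.Nonempty) (hB0 : B.Nonempty) (hC : ∀ x ∈ A, ∀ y ∈ B, x + y ∈ C) :
    volume A + volume B ≤ volume C := by
  by_cases hA1 : volume A = 0
  · obtain ⟨a, ha⟩ := hA0
    rw [hA1, zero_add]
    have h2 : volume ((fun x => a + x) '' B) = volume B := by simp
    rw [← h2]
    apply measure_mono
    rintro _ ⟨y, hy, rfl⟩
    exact hC _ ha _ hy
  by_cases hB1 : volume B = 0
  · obtain ⟨b, hb⟩ := hB0
    rw [hB1, add_zero]
    have h2 : volume ((fun x => x + b) '' A) = volume A := by simp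
    rw [← h2]
    apply measure_mono
    rintro _ ⟨y, hy, rfl⟩
    exact hC _ hy _ hb
  apply le_of_forall_lt
  intro c hc
  obtain ⟨y, hy, z, hz, hyz⟩ := ENNReal.exists_lt_add_of_lt_add hc hA1 hB1
  obtain ⟨K, hKA, hK, hyK⟩ := hA.exists_lt_isCompact hy
  obtain ⟨L, hLB, hL, hzL⟩ := hB.exists_lt_isCompact hz
  have hK0 : K.Nonempty := by
    rw [nonempty_iff_ne_empty]; rintro rfl; simp at hyK
  have hL0 : L.Nonempty := by
    rw [nonempty_iff_ne_empty]; rintro rfl; simp at hzL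
  calc c < y + z := hyz
    _ ≤ volume K + volume L := by gcongr
    _ ≤ volume (K + L) := bm_compact K L hK hL hK0 hL0
    _ ≤ volume C := by
      apply measure_mono
      rintro _ ⟨x, hx, y, hy, rfl⟩
      exact hC _ (hKA hx) _ (hLB hy)

theorem pl_norm (l : ℝ) (hl0 : 0 < l) (hl1 : l < 1) (f g h : ℝ → ℝ) (hf : Measurable f)
    (hg : Measurable g) (hh : Measurable h) (hf0 : ∀ x, 0 ≤ f x) (hg0 : ∀ x, 0 ≤ g x)
    (hh0 : ∀ x, 0 ≤ h x) (hf1 : ∀ x, f x ≤ 1) (hg1 : ∀ x, g x ≤ 1)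
    (hfs : ∀ s < 1, ∃ x, s < f x) (hgs : ∀ s < 1, ∃ x, s < g x)
    (H : ∀ x y, f x ^ l * g y ^ (1 - l) ≤ h (l * x + (1 - l) * y)) :
    ENNReal.ofReal l * (∫⁻ x, ENNReal.ofReal (f x)) +
      ENNReal.ofReal (1 - l) * (∫⁻ x, ENNReal.ofReal (g x)) ≤ ∫⁻ x, ENNReal.ofReal (h x) := by
  have hl1' : 0 < 1 - l := by linarith
  rw [lintegral_eq_lintegral_meas_lt _ (Eventually.of_forall hf0) hf.aemeasurable,
    lintegral_eq_lintegral_meas_lt _ (Eventually.of_forall hg0) hg.aemeasurable,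
    lintegral_eq_lintegral_meas_lt _ (Eventually.of_forall hh0) hh.aemeasurable]
  have anti : ∀ u : ℝ → ℝ, Measurable fun s : ℝ => volume {a | s < u a} := by
    intro u
    apply Antitone.measurable
    intro s t hst
    exact measure_mono fun x hx => lt_of_le_of_lt hst hx
  rw [← lintegral_const_mul _ (anti f), ← lintegral_const_mul _ (anti g),
    ← lintegral_add_left ((anti f).const_mul _)]
  apply lintegral_mono_ae
  filter_upwards [ae_restrict_mem measurableSet_Ioi] with s hs
  have hs0 : 0 < s := hs
  by_cases hs1 : s < 1
  · have e1 : ENNReal.ofReal l * volume {a | s < f a} = volume (l • {a | s < f a}) := by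
      rw [Measure.addHaar_smul]; simp [abs_of_pos hl0]
    have e2 : ENNReal.ofReal (1 - l) * volume {a | s < g a}
        = volume ((1 - l) • {a | s < g a}) := by
      rw [Measure.addHaar_smul]; simp [abs_of_pos hl1']
    rw [e1, e2]
    apply bm_one
    · exact (measurableSet_lt measurable_const hf).const_smul₀ l
    · exact (measurableSet_lt measurable_const hg).const_smul₀ (1 - l)
    · exact Set.Nonempty.smul_set (hfs s hs1)
    · exact Set.Nonempty.smul_set (hgs s hs1)
    · rintro _ ⟨x, hx, rfl⟩ _ ⟨y, hy, rfl⟩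
      have hx' : s < f x := hx
      have hy' : s < g y := hy
      refine lt_of_lt_of_le ?_ (H x y)
      calc s = s ^ l * s ^ (1 - l) := by rw [← Real.rpow_add hs0]; simp
        _ < _ := by
          apply mul_lt_mul (Real.rpow_lt_rpow hs0.le hx' hl0)
            (Real.rpow_le_rpow hs0.le hy'.le hl1'.le) (by positivity)
            (Real.rpow_nonneg (hf0 _) _)
  · have e1 : {a | s < f a} = ∅ := by
      ext x; simp; linarith [hf1 x]
    have e2 : {a | s < g a} = ∅ := by
      ext x; simp; linarith [hg1 x]
    rw [e1, e2]; simp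

theorem ennreal_amgm (l : ℝ) (hl0 : 0 < l) (hl1 : l < 1) (a b : ENNReal) :
    a ^ l * b ^ (1 - l) ≤ ENNReal.ofReal l * a + ENNReal.ofReal (1 - l) * b := by
  have hl1' : 0 < 1 - l := by linarith
  by_cases ha : a = ⊤
  · subst ha
    rw [ENNReal.mul_top (by simpa using hl0)]; simp
  by_cases hb : b = ⊤
  · subst hb
    rw [ENNReal.mul_top (by simpa using hl1)]; simp
  lift a to NNReal using ha
  lift b to NNReal using hb
  have := NNReal.geom_mean_le_arith_mean2_weighted (⟨l, hl0.le⟩) ⟨1 - l, hl1'.le⟩ a b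
    (by apply NNReal.eq; show l + (1 - l) = 1; ring)
  rw [← ENNReal.coe_rpow_of_nonneg _ hl0.le, ← ENNReal.coe_rpow_of_nonneg _ hl1'.le,
    ENNReal.ofReal_eq_coe_nnreal hl0.le, ENNReal.ofReal_eq_coe_nnreal hl1'.le]
  exact_mod_cast this

theorem pl_bdd (l : ℝ) (hl0 : 0 < l) (hl1 : l < 1) (f g h : ℝ → ℝ) (hf : Measurable f)
    (hg : Measurable g) (hh : Measurable h) (hf0 : ∀ x, 0 ≤ f x) (hg0 : ∀ x, 0 ≤ g x)
    (hh0 : ∀ x, 0 ≤ h x) (N : ℝ) (hf1 : ∀ x, f x ≤ N) (hg1 : ∀ x, g x ≤ N)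
    (H : ∀ x y, f x ^ l * g y ^ (1 - l) ≤ h (l * x + (1 - l) * y)) :
    (∫⁻ x, ENNReal.ofReal (f x)) ^ l * (∫⁻ x, ENNReal.ofReal (g x)) ^ (1 - l)
      ≤ ∫⁻ x, ENNReal.ofReal (h x) := by
  have hl1' : 0 < 1 - l := by linarith
  have hfb : BddAbove (range f) := ⟨N, by rintro _ ⟨x, rfl⟩; exact hf1 x⟩
  have hgb : BddAbove (range g) := ⟨N, by rintro _ ⟨x, rfl⟩; exact hg1 x⟩
  set a := ⨆ x, f x with ha
  set b := ⨆ x, g x with hb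
  have hfa : ∀ x, f x ≤ a := le_ciSup hfb
  have hgb' : ∀ x, g x ≤ b := le_ciSup hgb
  have ha0 : 0 ≤ a := (hf0 0).trans (hfa 0)
  have hb0 : 0 ≤ b := (hg0 0).trans (hgb' 0)
  rcases eq_or_lt_of_le ha0 with ha1 | ha1
  · have : ∀ x, f x = 0 := fun x => le_antisymm (ha1 ▸ hfa x) (hf0 x)
    simp [this, hl0]
  rcases eq_or_lt_of_le hb0 with hb1 | hb1
  · have : ∀ x, g x = 0 := fun x => le_antisymm (hb1 ▸ hgb' x) (hg0 x)
    simp [this, hl1]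
  set c := a ^ l * b ^ (1 - l) with hc
  have hc0 : 0 < c := by positivity
  have key := pl_norm l hl0 hl1 (fun x => f x / a) (fun x => g x / b) (fun x => h x / c)
    (by fun_prop) (by fun_prop) (by fun_prop)
    (fun x => div_nonneg (hf0 x) ha0) (fun x => div_nonneg (hg0 x) hb0)
    (fun x => div_nonneg (hh0 x) hc0.le) (fun x => (div_le_one ha1).2 (hfa x))
    (fun x => (div_le_one hb1).2 (hgb' x))
    (fun s hs => by
      have : s * a < ⨆ x, f x := by rw [← ha]; nlinarith
      obtain ⟨x, hx⟩ := exists_lt_of_lt_ciSup this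
      exact ⟨x, (lt_div_iff₀ ha1).2 hx⟩)
    (fun s hs => by
      have : s * b < ⨆ x, g x := by rw [← hb]; nlinarith
      obtain ⟨x, hx⟩ := exists_lt_of_lt_ciSup this
      exact ⟨x, (lt_div_iff₀ hb1).2 hx⟩)
    (fun x y => by
      rw [Real.div_rpow (hf0 _) ha0, Real.div_rpow (hg0 _) hb0, div_mul_div_comm]
      gcongr
      exact H x y)
  have sc : ∀ (u : ℝ → ℝ) (d : ℝ), Measurable u → 0 < d → ∫⁻ x, ENNReal.ofReal (u x)
      = ENNReal.ofReal d * ∫⁻ x, ENNReal.ofReal (u x / d) := by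
    intro u d hu hd
    rw [← lintegral_const_mul _ (by fun_prop)]
    apply lintegral_congr
    intro x
    rw [← ENNReal.ofReal_mul hd.le]
    congr 1
    field_simp
  rw [sc f a hf ha1, sc g b hg hb1, sc h c hh hc0]
  rw [ENNReal.mul_rpow_of_nonneg _ _ hl0.le, ENNReal.mul_rpow_of_nonneg _ _ hl1'.le,
    ENNReal.ofReal_rpow_of_pos ha1, ENNReal.ofReal_rpow_of_pos hb1, mul_mul_mul_comm,
    ← ENNReal.ofReal_mul (by positivity)]
  gcongr
  exact (ennreal_amgm l hl0 hl1 _ _).trans key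

/-- The Prékopa-Leindler inequality for a fixed weight. -/
def PL (l : ℝ) (E : Type) [AddCommGroup E] [Module ℝ E] [MeasurableSpace E]
    (m : Measure E) : Prop :=
  ∀ f g h : E → ENNReal, Measurable f → Measurable g → Measurable h →
    (∀ x y, f x ^ l * g y ^ (1 - l) ≤ h (l • x + (1 - l) • y)) →
    (∫⁻ x, f x ∂m) ^ l * (∫⁻ x, g x ∂m) ^ (1 - l) ≤ ∫⁻ x, h x ∂m

theorem pl_real (l : ℝ) (hl0 : 0 < l) (hl1 : l < 1) : PL l ℝ volume := by
  intro f g h hf hg hh H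
  have hl1' : 0 < 1 - l := by linarith
  have hN : ∀ N : ℕ, (∫⁻ x, min (f x) N) ^ l * (∫⁻ x, min (g x) N) ^ (1 - l) ≤ ∫⁻ x, h x := by
    intro N
    have fin : ∀ (u : ENNReal), min u N ≠ ⊤ := fun u =>
      ne_top_of_le_ne_top (ENNReal.natCast_ne_top N) (min_le_right _ _)
    have bd : ∀ (u : ENNReal), (min u N).toReal ≤ N := fun u => by
      have := ENNReal.toReal_mono (ENNReal.natCast_ne_top N) (min_le_right u (N : ENNReal))
      simpa using this
    have key := pl_bdd l hl0 hl1 (fun x => (min (f x) N).toReal) (fun x => (min (g x) N).toReal)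
      (fun x => (min (h x) N).toReal) (by fun_prop) (by fun_prop) (by fun_prop)
      (fun _ => ENNReal.toReal_nonneg) (fun _ => ENNReal.toReal_nonneg)
      (fun _ => ENNReal.toReal_nonneg) N (fun x => bd _) (fun x => bd _)
      (fun x y => by
        rw [ENNReal.toReal_rpow, ENNReal.toReal_rpow, ← ENNReal.toReal_mul]
        apply ENNReal.toReal_mono (fin _)
        apply le_min
        · refine le_trans ?_ (H x y)
          gcongr
          · exact min_le_left _ _
          · exact min_le_left _ _
        · calc _ ≤ (N : ENNReal) ^ l * (N : ENNReal) ^ (1 - l) := by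
                gcongr
                · exact min_le_right _ _
                · exact min_le_right _ _
            _ = N := by
                rw [← ENNReal.rpow_add_of_nonneg _ _ hl0.le hl1'.le]; simp)
    simp only [ENNReal.ofReal_toReal (fin _)] at key
    exact key.trans (lintegral_mono fun x => min_le_left _ _)
  have conv : ∀ u : ℝ → ENNReal, Measurable u →
      Tendsto (fun N : ℕ => ∫⁻ x, min (u x) N) atTop (nhds (∫⁻ x, u x)) := by
    intro u hu
    apply lintegral_tendsto_of_tendsto_of_monotone
    · intro N; fun_prop
    · refine Eventually.of_forall fun x => ?_
      intro N N' hNN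
      exact min_le_min le_rfl (by exact_mod_cast hNN)
    · refine Eventually.of_forall fun x => ?_
      have := (tendsto_const_nhds (x := u x)).min ENNReal.tendsto_nat_nhds_top
      simpa using this
  by_cases h1 : ∫⁻ x, f x = 0
  · simp [h1, hl0]
  by_cases h2 : ∫⁻ x, g x = 0
  · simp [h2, hl1]
  have t1 := ((ENNReal.continuous_rpow_const (y := l)).tendsto _).comp (conv f hf)
  have t2 := ((ENNReal.continuous_rpow_const (y := 1 - l)).tendsto _).comp (conv g hg)
  have p1 : (∫⁻ x, f x) ^ l ≠ 0 := by simp [h1, hl0.le, ENNReal.rpow_eq_zero_iff]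
  have p2 : (∫⁻ x, g x) ^ (1 - l) ≠ 0 := by simp [h2, hl1.le, ENNReal.rpow_eq_zero_iff]
  exact le_of_tendsto' (ENNReal.Tendsto.mul t1 (Or.inl p1) t2 (Or.inl p2)) hN

theorem pl_prod (l : ℝ) {E F : Type} [AddCommGroup E] [Module ℝ E] [MeasurableSpace E]
    [AddCommGroup F] [Module ℝ F] [MeasurableSpace F] (m : Measure E) (m' : Measure F)
    [SFinite m] [SFinite m'] (hE : PL l E m) (hF : PL l F m') : PL l (E × F) (m.prod m') := by
  intro f g h hf hg hh H
  rw [lintegral_prod _ hf.aemeasurable, lintegral_prod _ hg.aemeasurable,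
    lintegral_prod _ hh.aemeasurable]
  apply hE _ _ _ hf.lintegral_prod_right' hg.lintegral_prod_right' hh.lintegral_prod_right'
  intro x y
  exact hF _ _ _ (hf.comp measurable_prodMk_left) (hg.comp measurable_prodMk_left)
    (hh.comp measurable_prodMk_left) (fun x' y' => H (x, x') (y, y'))

theorem pl_transport (l : ℝ) {E F : Type} [AddCommGroup E] [Module ℝ E] [MeasurableSpace E]
    [AddCommGroup F] [Module ℝ F] [MeasurableSpace F] (m : Measure E) (m' : Measure F)
    (e : E → F) (he : MeasurePreserving e m m')
    (hlin : ∀ x y, e (l • x + (1 - l) • y) = l • e x + (1 - l) • e y)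
    (hE : PL l E m) : PL l F m' := by
  intro f g h hf hg hh H
  rw [← he.lintegral_comp hf, ← he.lintegral_comp hg, ← he.lintegral_comp hh]
  apply hE _ _ _ (hf.comp he.measurable) (hg.comp he.measurable) (hh.comp he.measurable)
  intro x y
  simp only [Function.comp]
  rw [hlin]
  exact H _ _

theorem pl_pi (l : ℝ) (hl0 : 0 < l) (hl1 : l < 1) (n : ℕ) : PL l (Fin n → ℝ) volume := by
  induction n with
  | zero =>
    intro f g h hf hg hh H
    simp only [lintegral_unique]
    have : (volume : Measure (Fin 0 → ℝ)) univ = 1 := by simp [volume_pi]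
    rw [this]
    simp only [mul_one]
    refine (H _ _).trans (le_of_eq ?_)
    congr 1
    exact Subsingleton.elim _ _
  | succ n ih =>
    have hp := pl_prod l volume volume (pl_real l hl0 hl1) ih
    refine pl_transport l _ _ (MeasurableEquiv.piFinSuccAbove (fun _ : Fin (n + 1) => ℝ) 0).symm
      (volume_preserving_piFinSuccAbove (fun _ : Fin (n + 1) => ℝ) 0).symm ?_ hp
    intro x y
    ext i
    refine Fin.cases ?_ (fun j => ?_) i
    · simp [MeasurableEquiv.piFinSuccAbove]
    · simp [MeasurableEquiv.piFinSuccAbove]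

theorem pl_euc (l : ℝ) (hl0 : 0 < l) (hl1 : l < 1) (n : ℕ) : PL l (Euc n) volume :=
  pl_transport l _ _ _ (PiLp.volume_preserving_toLp (Fin n)) (fun _ _ => rfl)
    (pl_pi l hl0 hl1 n)
/-! ### Part 4: one-dimensional estimates -/

theorem exp_int (r : ℝ) (hr : 0 < r) :
    IntegrableOn (fun t : ℝ => Real.exp (-(r * t))) (Ioi 0) ∧
    IntegrableOn (fun t : ℝ => t * Real.exp (-(r * t))) (Ioi 0) ∧
    ∫ t in Ioi (0:ℝ), Real.exp (-(r * t)) = 1 / r ∧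
    ∫ t in Ioi (0:ℝ), t * Real.exp (-(r * t)) = 1 / r ^ 2 := by
  have h1 := Real.integral_rpow_mul_exp_neg_mul_Ioi (a := 1) (by norm_num) hr
  have h2 := Real.integral_rpow_mul_exp_neg_mul_Ioi (a := 2) (by norm_num) hr
  have e2 : (2:ℝ) - 1 = 1 := by norm_num
  simp only [sub_self, Real.rpow_zero, one_mul, Real.Gamma_one, mul_one, Real.rpow_one] at h1
  simp only [e2, Real.rpow_one, Real.Gamma_two, mul_one, Real.rpow_two] at h2
  have h2' : ∫ t in Ioi (0:ℝ), t * Real.exp (-(r * t)) = 1 / r ^ 2 := by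
    rw [h2]; simp
  refine ⟨?_, ?_, h1, h2'⟩
  · by_contra h
    have := integral_undef h
    rw [h1] at this
    have : 0 < 1 / r := by positivity
    linarith
  · by_contra h
    have := integral_undef h
    rw [h2'] at this
    have : 0 < 1 / r ^ 2 := by positivity
    linarith

theorem crossing (S : ℝ → ℝ) (hS0 : ∀ t, 0 ≤ S t) (h0 : 0.94 ≤ S 0)
    (hlc : ∀ t, 0 ≤ t → ∀ l, 0 < l → l < 1 → S t ^ l * S 0 ^ (1 - l) ≤ S (l * t))
    (hi1 : IntegrableOn S (Ioi 0)) (hi2 : IntegrableOn (fun t => t * S t) (Ioi 0))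
    (h1 : ∫ t in Ioi (0:ℝ), S t ≤ 0.56) : ∫ t in Ioi (0:ℝ), t * S t ≤ 0.42 := by
  obtain ⟨g1, g2, g3, g4⟩ := exp_int (3/2) (by norm_num)
  set g : ℝ → ℝ := fun t => 0.94 * Real.exp (-(3/2 * t)) with hg
  have gi1 : IntegrableOn g (Ioi 0) := g1.const_mul _
  have gi2 : IntegrableOn (fun t => t * g t) (Ioi 0) := by
    refine (g2.const_mul 0.94).congr (Eventually.of_forall fun t => ?_)
    simp only [hg]; ring
  have gI1 : ∫ t in Ioi (0:ℝ), g t = 0.94 * (2/3) := by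
    simp only [hg]; rw [integral_const_mul, g3]; norm_num
  have gI2 : ∫ t in Ioi (0:ℝ), t * g t = 0.94 * (4/9) := by
    have : ∀ t, t * g t = 0.94 * (t * Real.exp (-(3/2 * t))) := fun t => by simp only [hg]; ring
    simp only [this]; rw [integral_const_mul, g4]; norm_num
  have down : ∀ t s, 0 < s → s < t → g t ≤ S t → g s ≤ S s := by
    intro t s hs hst ht
    have htp : 0 < t := hs.trans hst
    have hl1 : s / t < 1 := (div_lt_one htp).2 hst
    have := hlc t htp.le (s / t) (by positivity) hl1
    rw [div_mul_cancel₀ _ htp.ne'] at this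
    refine le_trans ?_ this
    calc g s = g t ^ (s / t) * 0.94 ^ (1 - s / t) := by
          simp only [hg]
          rw [Real.mul_rpow (by norm_num) (Real.exp_pos _).le, ← Real.exp_mul, mul_right_comm,
            ← Real.rpow_add (by norm_num)]
          simp
          field_simp
          simp
      _ ≤ _ := by
          have : 0 ≤ g t := by simp only [hg]; positivity
          have : 0 ≤ 1 - s / t := by linarith
          have := Real.rpow_nonneg (hS0 t) (s / t)
          gcongr
  by_cases hall : ∀ t, 0 < t → g t ≤ S t
  · have := setIntegral_mono_on gi1 hi1 measurableSet_Ioi (fun t ht => hall t ht)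
    rw [gI1] at this
    norm_num at *
    linarith
  push Not at hall
  obtain ⟨t0, ht0, hlt0⟩ := hall
  set P : Set ℝ := {t | t = 0 ∨ 0 < t ∧ g t ≤ S t} with hP
  have hPb : ∀ t ∈ P, t ≤ t0 := by
    rintro t (rfl | ⟨h, h'⟩)
    · exact ht0.le
    · by_contra hc
      push Not at hc
      exact absurd (down t t0 ht0 hc h') (not_le.2 hlt0)
  have hPB : BddAbove P := ⟨t0, hPb⟩
  set c := sSup P with hc
  have hc0 : 0 ≤ c := le_csSup hPB (Or.inl rfl)
  have hpt : ∀ t, 0 < t → t * S t - c * S t ≤ t * g t - c * g t := by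
    intro t ht
    rcases lt_trichotomy t c with h | h | h
    · obtain ⟨s, hs, hts⟩ := exists_lt_of_lt_csSup (s := P) ⟨0, Or.inl rfl⟩ h
      have : g t ≤ S t := by
        rcases hs with rfl | ⟨h3, h4⟩
        · linarith
        · exact down s t ht hts h4
      nlinarith
    · rw [h]; linarith
    · have : S t < g t := by
        by_contra h3
        push Not at h3
        have := le_csSup hPB (show t ∈ P from Or.inr ⟨ht, h3⟩)
        linarith
      nlinarith
  have := setIntegral_mono_on (hi2.sub (hi1.const_mul c)) (gi2.sub (gi1.const_mul c))
    measurableSet_Ioi (fun t ht => hpt t ht)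
  simp only [Pi.sub_apply] at this
  rw [integral_sub hi2 (hi1.const_mul c), integral_sub gi2 (gi1.const_mul c),
    integral_const_mul, integral_const_mul, gI1, gI2] at this
  norm_num at *
  nlinarith

theorem tail_bound (T : ℝ → ℝ) (hT0 : ∀ t, 0 ≤ T t) (h2 : 3/4 ≤ T (-2)) (hh : T (1/2) ≤ 0.06)
    (hlc : ∀ a b l, 0 < l → l < 1 → T a ^ l * T b ^ (1 - l) ≤ T (l * a + (1 - l) * b))
    (s : ℝ) (hs : 0 < s) : T (1/2 + s) ≤ 0.06 * Real.exp (-(1 * s)) := by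
  have hd : 0 < 2.5 + s := by positivity
  have h := hlc (-2) (1/2 + s) (s / (2.5 + s)) (by positivity) (by rw [div_lt_one hd]; linarith)
  have e1 : s / (2.5 + s) * (-2) + (1 - s / (2.5 + s)) * (1/2 + s) = 1/2 := by
    field_simp; ring
  have e2 : 1 - s / (2.5 + s) = 2.5 / (2.5 + s) := by field_simp; ring
  rw [e1, e2] at h
  have h3 : (3/4:ℝ) ^ (s / (2.5 + s)) * T (1/2 + s) ^ (2.5 / (2.5 + s)) ≤ 0.06 := by
    refine le_trans ?_ (h.trans hh)
    have := hT0 (1/2 + s)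
    gcongr
  have h4 := Real.rpow_le_rpow (mul_nonneg (by positivity) (Real.rpow_nonneg (hT0 _) _)) h3
    (show 0 ≤ (2.5 + s) / 2.5 by positivity)
  rw [Real.mul_rpow (by positivity) (Real.rpow_nonneg (hT0 _) _), ← Real.rpow_mul (by norm_num),
    ← Real.rpow_mul (hT0 _)] at h4
  have e3 : s / (2.5 + s) * ((2.5 + s) / 2.5) = s / 2.5 := by field_simp
  have e4 : 2.5 / (2.5 + s) * ((2.5 + s) / 2.5) = 1 := by field_simp
  have e5 : (2.5 + s) / 2.5 = 1 + s / 2.5 := by field_simp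
  rw [e3, e4, e5, Real.rpow_one, Real.rpow_add (by norm_num), Real.rpow_one] at h4
  have h5 : (0.06:ℝ) ^ (s / 2.5) ≤ (3/4:ℝ) ^ (s / 2.5) * Real.exp (-(1 * s)) := by
    have : Real.exp (-(1 * s)) = Real.exp (-2.5) ^ (s / 2.5) := by
      rw [← Real.exp_mul]; congr 1; field_simp
    rw [this, ← Real.mul_rpow (by norm_num) (Real.exp_pos _).le]
    apply Real.rpow_le_rpow (by norm_num) _ (by positivity)
    have h6 : Real.exp 2.5 ≤ 12.5 := by
      have h7 := Real.exp_one_lt_d9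
      have h8 : Real.exp 2.5 ^ 2 = Real.exp 1 ^ 5 := by
        rw [← Real.exp_nat_mul, ← Real.exp_nat_mul]; norm_num
      have h9 : Real.exp 1 ^ 5 ≤ 2.72 ^ 5 := by
        gcongr
        linarith
      rw [← h8] at h9
      have h10 := Real.exp_pos 2.5
      by_contra hcon
      push Not at hcon
      norm_num at *
      nlinarith
    rw [Real.exp_neg]
    have : (0.08:ℝ) ≤ (Real.exp 2.5)⁻¹ := by
      rw [le_inv_comm₀ (by norm_num) (Real.exp_pos _)]
      refine h6.trans (by norm_num)
    norm_num at *
    linarith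
  have h11 : (0:ℝ) < (3/4:ℝ) ^ (s / 2.5) := by positivity
  have h12 : (3/4:ℝ) ^ (s / 2.5) * T (1/2 + s) ≤ (3/4:ℝ) ^ (s / 2.5) * (0.06 * Real.exp (-(1 * s))) := by
    refine h4.trans ?_
    calc _ ≤ 0.06 * ((3/4:ℝ) ^ (s / 2.5) * Real.exp (-(1 * s))) := by gcongr
      _ = _ := by ring
  exact le_of_mul_le_mul_left h12 h11

theorem layer (ν : Measure ℝ) [IsProbabilityMeasure ν] (u : ℝ → ℝ) (hu : Measurable u)
    (hu0 : ∀ x, 0 ≤ u x) (h1 : Integrable u ν) (h2 : Integrable (fun x => u x ^ 2) ν) :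
    IntegrableOn (fun t => ν.real {x | t ≤ u x}) (Ioi 0) ∧
    IntegrableOn (fun t => t * ν.real {x | t ≤ u x}) (Ioi 0) ∧
    ∫ x, u x ∂ν = ∫ t in Ioi (0:ℝ), ν.real {x | t ≤ u x} ∧
    ∫ x, u x ^ 2 ∂ν = 2 * ∫ t in Ioi (0:ℝ), t * ν.real {x | t ≤ u x} := by
  have anti : Antitone fun t : ℝ => ν.real {x | t ≤ u x} := by
    intro s t hst
    exact measureReal_mono fun x hx => le_trans hst hx
  have am := anti.measurable
  have k1 := lintegral_eq_lintegral_meas_le ν (Eventually.of_forall hu0) hu.aemeasurable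
  have k2 := lintegral_rpow_eq_lintegral_meas_le_mul ν (Eventually.of_forall hu0) hu.aemeasurable
    (p := 2) (by norm_num)
  have e1 : ∫⁻ t in Ioi (0:ℝ), ν {x | t ≤ u x}
      = ∫⁻ t in Ioi (0:ℝ), ENNReal.ofReal (ν.real {x | t ≤ u x}) := by
    apply lintegral_congr; intro t; rw [ofReal_measureReal]
  have e2 : ∫⁻ t in Ioi (0:ℝ), ν {x | t ≤ u x} * ENNReal.ofReal (t ^ ((2:ℝ) - 1))
      = ∫⁻ t in Ioi (0:ℝ), ENNReal.ofReal (t * ν.real {x | t ≤ u x}) := by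
    apply setLIntegral_congr_fun measurableSet_Ioi
    intro t ht
    have ht' : (0:ℝ) < t := ht
    have : (2:ℝ) - 1 = 1 := by norm_num
    simp only [this, Real.rpow_one]
    rw [ENNReal.ofReal_mul ht'.le, ofReal_measureReal, mul_comm]
  rw [e1] at k1
  rw [e2] at k2
  simp only [Real.rpow_two] at k2
  have n2 : 0 ≤ᵐ[volume.restrict (Ioi (0:ℝ))] fun t : ℝ => t * ν.real {x | t ≤ u x} := by
    filter_upwards [ae_restrict_mem measurableSet_Ioi] with t ht
    exact mul_nonneg (le_of_lt ht) measureReal_nonneg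
  have n1 : 0 ≤ᵐ[volume.restrict (Ioi (0:ℝ))] fun t : ℝ => ν.real {x | t ≤ u x} :=
    Eventually.of_forall fun t => measureReal_nonneg
  have f1 := (hasFiniteIntegral_iff_ofReal (Eventually.of_forall hu0)).1 h1.2
  have f2 := (hasFiniteIntegral_iff_ofReal (Eventually.of_forall fun x => sq_nonneg (u x))).1 h2.2
  refine ⟨⟨am.aestronglyMeasurable, (hasFiniteIntegral_iff_ofReal n1).2 (k1 ▸ f1)⟩,
    ⟨(measurable_id.mul am).aestronglyMeasurable, (hasFiniteIntegral_iff_ofReal n2).2 ?_⟩, ?_, ?_⟩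
  · rw [k2] at f2
    by_contra hcon
    rw [not_lt, top_le_iff] at hcon
    rw [hcon, ENNReal.mul_top (by simp)] at f2
    exact lt_irrefl _ f2
  · rw [integral_eq_lintegral_of_nonneg_ae (Eventually.of_forall hu0) hu.aestronglyMeasurable, k1,
      integral_eq_lintegral_of_nonneg_ae n1 am.aestronglyMeasurable]
  · rw [integral_eq_lintegral_of_nonneg_ae (Eventually.of_forall fun x => sq_nonneg (u x))
      (hu.pow_const 2).aestronglyMeasurable, k2,
      integral_eq_lintegral_of_nonneg_ae n2 (measurable_id.mul am).aestronglyMeasurable,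
      ENNReal.toReal_mul]
    simp

theorem one_dim (ν : Measure ℝ) [IsProbabilityMeasure ν]
    (hT : ∀ a b l, 0 < l → l < 1 →
      ν.real (Ici a) ^ l * ν.real (Ici b) ^ (1 - l) ≤ ν.real (Ici (l * a + (1 - l) * b)))
    (hF : ∀ a b l, 0 < l → l < 1 →
      ν.real (Iic a) ^ l * ν.real (Iic b) ^ (1 - l) ≤ ν.real (Iic (l * a + (1 - l) * b)))
    (hi1 : Integrable (fun x => x) ν) (hi2 : Integrable (fun x => x ^ 2) ν)
    (m1 : ∫ x, x ∂ν = 0) (m2 : ∫ x, x ^ 2 ∂ν = 1) (hh : ν.real (Ici (1/2)) ≤ 0.06) : False := by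
  -- Chebyshev
  have ch : 3/4 ≤ ν.real (Ici (-2)) := by
    have h1 := mul_meas_ge_le_integral_of_nonneg (μ := ν) (f := fun x : ℝ => x ^ 2)
      (Eventually.of_forall fun x => sq_nonneg x) hi2 4
    rw [m2] at h1
    have h2 : ν.real (Iio (-2)) ≤ ν.real {x : ℝ | 4 ≤ x ^ 2} := by
      refine measureReal_mono fun x hx => ?_
      have : x < -2 := hx
      show 4 ≤ x ^ 2
      nlinarith
    have h3 := probReal_compl_eq_one_sub (μ := ν) (measurableSet_Iio (a := (-2:ℝ)))
    rw [compl_Iio] at h3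
    linarith
  have tb := tail_bound (fun t => ν.real (Ici t)) (fun t => measureReal_nonneg) ch hh hT
  set v : ℝ → ℝ := fun x => max (x - 1/2) 0 with hv
  set u : ℝ → ℝ := fun x => max (1/2 - x) 0 with hu
  have vm : Measurable v := by fun_prop
  have um : Measurable u := by fun_prop
  have v0 : ∀ x, 0 ≤ v x := fun x => le_max_right _ _
  have u0 : ∀ x, 0 ≤ u x := fun x => le_max_right _ _
  have iv : Integrable v ν := (hi1.sub (integrable_const _)).pos_part
  have iu : Integrable u ν := ((integrable_const (1/2:ℝ)).sub hi1).pos_part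
  have iq : Integrable (fun x : ℝ => (x - 1/2) ^ 2) ν := by
    have : (fun x : ℝ => (x - 1/2) ^ 2) = fun x : ℝ => x ^ 2 - x + 1/4 := by ext x; ring
    rw [this]
    exact (hi2.sub hi1).add (integrable_const _)
  have iv2 : Integrable (fun x => v x ^ 2) ν := by
    refine iq.mono' (by fun_prop) (Eventually.of_forall fun x => ?_)
    rw [Real.norm_of_nonneg (sq_nonneg _)]
    rcases le_total (x - 1/2) 0 with h | h
    · simp only [hv, max_eq_right h]; nlinarith
    · simp only [hv, max_eq_left h]; exact le_rfl
  have iu2 : Integrable (fun x => u x ^ 2) ν := by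
    refine iq.mono' (by fun_prop) (Eventually.of_forall fun x => ?_)
    rw [Real.norm_of_nonneg (sq_nonneg _)]
    rcases le_total (1/2 - x) 0 with h | h
    · simp only [hu, max_eq_right h]; nlinarith
    · simp only [hu, max_eq_left h]; nlinarith
  obtain ⟨a1, a2, a3, a4⟩ := layer ν v vm v0 iv iv2
  obtain ⟨b1, b2, b3, b4⟩ := layer ν u um u0 iu iu2
  have ev : ∀ t, 0 < t → {x | t ≤ v x} = Ici (1/2 + t) := by
    intro t ht
    ext x
    simp only [hv, mem_ofPred_eq, mem_Ici, le_max_iff]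
    constructor
    · rintro (h | h) <;> linarith
    · intro h; left; linarith
  have eu : ∀ t, 0 < t → {x | t ≤ u x} = Iic (1/2 - t) := by
    intro t ht
    ext x
    simp only [hu, mem_ofPred_eq, mem_Iic, le_max_iff]
    constructor
    · rintro (h | h) <;> linarith
    · intro h; left; linarith
  obtain ⟨g1, g2, g3, g4⟩ := exp_int 1 (by norm_num)
  have t1 : ∫ x, v x ∂ν ≤ 0.06 := by
    rw [a3]
    refine (setIntegral_mono_on a1 (g1.const_mul 0.06) measurableSet_Ioi ?_).trans ?_
    · intro t ht
      rw [ev t ht]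
      exact tb t ht
    · rw [integral_const_mul, g3]; norm_num
  have t2 : ∫ x, v x ^ 2 ∂ν ≤ 0.12 := by
    rw [a4]
    have : ∫ t in Ioi (0:ℝ), t * ν.real {x | t ≤ v x} ≤ 0.06 := by
      refine (setIntegral_mono_on a2 (g2.const_mul 0.06) measurableSet_Ioi ?_).trans ?_
      · intro t ht
        have ht' : (0:ℝ) < t := ht
        rw [ev t ht]
        have := tb t ht
        nlinarith
      · rw [integral_const_mul, g4]; norm_num
    norm_num at *
    linarith
  have r1 : ∫ x, u x ∂ν = 1/2 + ∫ x, v x ∂ν := by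
    have : ∫ x, (u x - v x) ∂ν = ∫ x, (1/2 - x) ∂ν := by
      apply integral_congr_ae
      refine Eventually.of_forall fun x => ?_
      simp only [hu, hv]
      rcases le_total (1/2 - x) 0 with h | h
      · rw [max_eq_right h, max_eq_left (by linarith)]; ring
      · rw [max_eq_left h, max_eq_right (by linarith)]; ring
    rw [integral_sub iu iv, integral_sub (integrable_const _) hi1, m1] at this
    simp at this
    linarith
  have r2 : ∫ x, u x ^ 2 ∂ν + ∫ x, v x ^ 2 ∂ν = 5/4 := by
    have : ∫ x, (u x ^ 2 + v x ^ 2) ∂ν = ∫ x, (x ^ 2 - x + 1/4) ∂ν := by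
      apply integral_congr_ae
      refine Eventually.of_forall fun x => ?_
      simp only [hu, hv]
      rcases le_total (1/2 - x) 0 with h | h
      · rw [max_eq_right h, max_eq_left (by linarith)]; ring
      · rw [max_eq_left h, max_eq_right (by linarith)]; ring
    have r3 : ∫ x, (x ^ 2 - x + 1/4) ∂ν = ∫ x, (x ^ 2 - x) ∂ν + ∫ x, (1/4 : ℝ) ∂ν :=
      integral_add (hi2.sub hi1) (integrable_const _)
    rw [integral_add iu2 iv2, r3, integral_sub hi2 hi1, m1, m2] at this
    rw [this]
    simp
    norm_num
  have s1 : ∫ t in Ioi (0:ℝ), ν.real {x | t ≤ u x} = ∫ t in Ioi (0:ℝ), ν.real (Iic (1/2 - t)) :=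
    setIntegral_congr_fun measurableSet_Ioi fun t ht => by simp only [eu t ht]
  have s2 : ∫ t in Ioi (0:ℝ), t * ν.real {x | t ≤ u x}
      = ∫ t in Ioi (0:ℝ), t * ν.real (Iic (1/2 - t)) :=
    setIntegral_congr_fun measurableSet_Ioi fun t ht => by simp only [eu t ht]
  have b1' : IntegrableOn (fun t => ν.real (Iic (1/2 - t))) (Ioi 0) :=
    b1.congr_fun (fun t ht => by simp only [eu t ht]) measurableSet_Ioi
  have b2' : IntegrableOn (fun t => t * ν.real (Iic (1/2 - t))) (Ioi 0) :=
    b2.congr_fun (fun t ht => by simp only [eu t ht]) measurableSet_Ioi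
  have fin := crossing (fun t => ν.real (Iic (1/2 - t))) (fun t => measureReal_nonneg)
    (by
      have h3 := probReal_compl_eq_one_sub (μ := ν) (measurableSet_Ici (a := (1/2:ℝ)))
      rw [compl_Ici] at h3
      have h4 : ν.real (Iio (1/2)) ≤ ν.real (Iic (1/2 - 0)) := by
        refine measureReal_mono fun x hx => ?_
        simp at hx ⊢
        exact hx.le
      norm_num at *
      linarith)
    (by
      intro t ht l hl0 hl1
      have := hF (1/2 - t) (1/2 - 0) l hl0 hl1
      have e : l * (1/2 - t) + (1 - l) * (1/2 - 0) = 1/2 - l * t := by ring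
      rw [e] at this
      exact this)
    b1' b2' (by rw [← s1, ← b3, r1]; norm_num at *; linarith)
  rw [← s2] at fin
  norm_num at *
  linarith

/-! ### Part 5: the ball of radius 1/2 lies in the super-level set -/

theorem lc_sets {n : ℕ} (f : Euc n → ℝ) (μ : Measure (Euc n)) [IsProbabilityMeasure μ]
    (hfm : Measurable f) (hf : IsLogConcaveFn f)
    (hμ : μ = volume.withDensity (fun x => ENNReal.ofReal (f x)))
    (l : ℝ) (hl0 : 0 < l) (hl1 : l < 1) (A B C : Set (Euc n)) (hA : MeasurableSet A)
    (hB : MeasurableSet B) (hC : MeasurableSet C)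
    (H : ∀ x ∈ A, ∀ y ∈ B, l • x + (1 - l) • y ∈ C) :
    μ.real A ^ l * μ.real B ^ (1 - l) ≤ μ.real C := by
  have hl1' : 0 < 1 - l := by linarith
  set F : Euc n → ENNReal := fun x => ENNReal.ofReal (f x) with hF
  have hFm : Measurable F := by fun_prop
  have e : ∀ D : Set (Euc n), MeasurableSet D → μ D = ∫⁻ x, D.indicator F x := by
    intro D hD
    rw [hμ, withDensity_apply _ hD, lintegral_indicator hD]
  have key := pl_euc l hl0 hl1 n (A.indicator F) (B.indicator F) (C.indicator F)
    (hFm.indicator hA) (hFm.indicator hB) (hFm.indicator hC) (by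
      intro x y
      by_cases hx : x ∈ A
      · by_cases hy : y ∈ B
        · rw [indicator_of_mem hx, indicator_of_mem hy, indicator_of_mem (H x hx y hy)]
          simp only [hF]
          rw [ENNReal.ofReal_rpow_of_nonneg (hf.1 _) hl0.le,
            ENNReal.ofReal_rpow_of_nonneg (hf.1 _) hl1'.le,
            ← ENNReal.ofReal_mul (Real.rpow_nonneg (hf.1 _) _)]
          exact ENNReal.ofReal_le_ofReal (hf.2 x y l hl0.le hl1.le)
        · rw [indicator_of_notMem hy]; simp [hl1]
      · rw [indicator_of_notMem hx]; simp [hl0])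
  rw [← e A hA, ← e B hB, ← e C hC] at key
  have := ENNReal.toReal_mono (measure_ne_top μ C) key
  rw [ENNReal.toReal_mul, ← ENNReal.toReal_rpow, ← ENNReal.toReal_rpow] at this
  exact this

theorem lintegral_scale {n : ℕ} (F : Euc n → ENNReal) (hF : Measurable F) (l : ℝ) (hl : 0 < l)
    (v : Euc n) : ∫⁻ x, F (l • x + v) = ENNReal.ofReal (l⁻¹ ^ n) * ∫⁻ x, F x := by
  have h1 : ∫⁻ x, F (l • x + v) = ∫⁻ y, F (y + v) ∂(Measure.map (l • ·) volume) := by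
    rw [lintegral_map (by fun_prop) (by fun_prop)]
  rw [h1, Measure.map_addHaar_smul _ hl.ne', lintegral_smul_measure, lintegral_add_right_eq_self]
  rw [finrank_euclideanSpace, Fintype.card_fin, abs_of_pos (by positivity), inv_pow, smul_eq_mul]

theorem lc_bounded {n : ℕ} (f : Euc n → ℝ) (hfm : Measurable f) (hf : IsLogConcaveFn f)
    (h1 : ∫⁻ x, ENNReal.ofReal (f x) = 1) : ∃ M, ∀ x, f x ≤ M := by
  set I := ∫⁻ x, ENNReal.ofReal (f x ^ (1/2:ℝ)) with hI
  have hI0 : I ≠ 0 := by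
    intro h0
    rw [hI, lintegral_eq_zero_iff (by fun_prop)] at h0
    have : ∫⁻ x, ENNReal.ofReal (f x) = 0 := by
      rw [lintegral_eq_zero_iff (by fun_prop)]
      filter_upwards [h0] with x hx
      simp only [Pi.zero_apply, ENNReal.ofReal_eq_zero] at hx ⊢
      by_contra hc
      push Not at hc
      have := Real.rpow_pos_of_pos hc (1/2)
      linarith
    rw [h1] at this
    exact one_ne_zero this
  set K := ENNReal.ofReal ((1/2:ℝ)⁻¹ ^ n) / I with hK
  have hKt : K ≠ ⊤ := ENNReal.div_ne_top ENNReal.ofReal_ne_top hI0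
  have hb : ∀ x0, ENNReal.ofReal (f x0 ^ (1/2:ℝ)) ≤ K := by
    intro x0
    rw [hK, ENNReal.le_div_iff_mul_le (Or.inl hI0) (Or.inr ENNReal.ofReal_ne_top), hI,
      ← lintegral_const_mul _ (by fun_prop)]
    have := lintegral_scale (fun x => ENNReal.ofReal (f x)) (by fun_prop) (1/2) (by norm_num)
      ((1 - 1/2 : ℝ) • x0)
    rw [h1, mul_one] at this
    rw [← this]
    apply lintegral_mono
    intro x
    simp only
    rw [← ENNReal.ofReal_mul (Real.rpow_nonneg (hf.1 _) _)]
    apply ENNReal.ofReal_le_ofReal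
    have h := hf.2 x x0 (1/2) (by norm_num) (by norm_num)
    have e : (1:ℝ) - 1/2 = 1/2 := by norm_num
    rw [mul_comm]
    rw [e] at h ⊢
    exact h
  refine ⟨K.toReal ^ 2, fun x => ?_⟩
  have := ENNReal.toReal_mono hKt (hb x)
  rw [ENNReal.toReal_ofReal (Real.rpow_nonneg (hf.1 _) _)] at this
  calc f x = (f x ^ (1/2:ℝ)) ^ 2 := by
        rw [← Real.rpow_natCast, ← Real.rpow_mul (hf.1 _)]; norm_num
    _ ≤ _ := by
      have := Real.rpow_nonneg (hf.1 x) (1/2)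
      gcongr

theorem lc_mass {n : ℕ} (hn : 0 < n) (f : Euc n → ℝ) (hfm : Measurable f) (hf : IsLogConcaveFn f)
    (h1 : ∫⁻ x, ENNReal.ofReal (f x) = 1) (M : ℝ) (hM : 0 < M)
    (x0 : Euc n) (hx0 : Real.exp (-(1/3)) * M ≤ f x0) :
    ∫⁻ x in {x | f x ≤ Real.exp (-(6 * n)) * M}, ENNReal.ofReal (f x) ≤ ENNReal.ofReal 0.06 := by
  have hfx0 : 0 < f x0 := lt_of_lt_of_le (by positivity) hx0
  have hn1 : (1:ℝ) ≤ n := by exact_mod_cast hn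
  set c := Real.exp (-(4.25 * n)) with hc
  have pt : ∀ x, f x ≤ Real.exp (-(6 * n)) * M →
      f x ≤ c * f ((1/4:ℝ) • x + (1 - 1/4 : ℝ) • x0) := by
    intro x hx
    have h := hf.2 x x0 (1/4) (by norm_num) (by norm_num)
    have e : (1:ℝ) - 1/4 = 3/4 := by norm_num
    have hfx := hf.1 x
    rw [e] at h ⊢
    refine le_trans ?_ (mul_le_mul_of_nonneg_left h (Real.exp_pos _).le)
    have h3 : f x ≤ Real.exp (-(6 * n) + 1/3) * f x0 := by
      calc f x ≤ Real.exp (-(6 * n)) * M := hx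
        _ = Real.exp (-(6 * n) + 1/3) * (Real.exp (-(1/3)) * M) := by
            rw [← mul_assoc, ← Real.exp_add]; congr 2; ring
        _ ≤ _ := by gcongr
    have h4 : f x ^ (3/4:ℝ) ≤ c * f x0 ^ (3/4:ℝ) := by
      calc f x ^ (3/4:ℝ) ≤ (Real.exp (-(6 * n) + 1/3) * f x0) ^ (3/4:ℝ) := by gcongr
        _ = Real.exp ((-(6 * n) + 1/3) * (3/4)) * f x0 ^ (3/4:ℝ) := by
            rw [Real.mul_rpow (Real.exp_pos _).le hfx0.le, ← Real.exp_mul]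
        _ ≤ _ := by
            gcongr
            rw [hc]
            apply Real.exp_le_exp.2
            norm_num
            linarith
    calc f x = f x ^ (1/4:ℝ) * f x ^ (3/4:ℝ) := by
          rw [← Real.rpow_add_of_nonneg hfx (by norm_num) (by norm_num)]; norm_num
      _ ≤ f x ^ (1/4:ℝ) * (c * f x0 ^ (3/4:ℝ)) := by
          have := Real.rpow_nonneg hfx (1/4)
          gcongr
      _ = _ := by ring
  calc ∫⁻ x in {x | f x ≤ Real.exp (-(6 * n)) * M}, ENNReal.ofReal (f x)
      ≤ ∫⁻ x in {x | f x ≤ Real.exp (-(6 * n)) * M},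
          ENNReal.ofReal c * ENNReal.ofReal (f ((1/4:ℝ) • x + (1 - 1/4 : ℝ) • x0)) := by
        apply setLIntegral_mono' (measurableSet_le hfm measurable_const)
        intro x hx
        rw [← ENNReal.ofReal_mul (Real.exp_pos _).le]
        exact ENNReal.ofReal_le_ofReal (pt x hx)
    _ ≤ ∫⁻ x, ENNReal.ofReal c * ENNReal.ofReal (f ((1/4:ℝ) • x + (1 - 1/4 : ℝ) • x0)) :=
        setLIntegral_le_lintegral _ _
    _ = ENNReal.ofReal (c * 4 ^ n) := by
        rw [lintegral_const_mul _ (by fun_prop),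
          lintegral_scale (fun x => ENNReal.ofReal (f x)) (by fun_prop) (1/4) (by norm_num), h1,
          mul_one, ← ENNReal.ofReal_mul (Real.exp_pos _).le, one_div, inv_inv]
    _ ≤ _ := by
        apply ENNReal.ofReal_le_ofReal
        have h5 : Real.exp (-4.25) ≤ 0.015 := by
          have h7 := Real.exp_one_gt_d9
          have h8 : Real.exp 4.25 ^ 4 = Real.exp 1 ^ 17 := by
            rw [← Real.exp_nat_mul, ← Real.exp_nat_mul]; norm_num
          have h9 : (2.718:ℝ) ^ 17 ≤ Real.exp 1 ^ 17 := by
            gcongr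
            linarith
          have h10 : (1/0.015:ℝ) ^ 4 ≤ Real.exp 4.25 ^ 4 := by
            rw [h8]; refine le_trans ?_ h9; norm_num
          have h11 := le_of_pow_le_pow_left₀ (by norm_num) (Real.exp_pos _).le h10
          rw [Real.exp_neg, inv_le_comm₀ (Real.exp_pos _) (by norm_num)]
          refine le_trans ?_ h11
          norm_num
        have h6 : c = Real.exp (-4.25) ^ n := by
          rw [← Real.exp_nat_mul, hc]; congr 1; ring
        rw [h6, ← mul_pow]
        calc (Real.exp (-4.25) * 4) ^ n ≤ (0.06:ℝ) ^ n := by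
              gcongr
              norm_num at *
              linarith
          _ ≤ 0.06 ^ 1 := pow_le_pow_of_le_one (by norm_num) (by norm_num) hn
          _ = _ := by norm_num

theorem moments {n : ℕ} (μ : Measure (Euc n)) [IsProbabilityMeasure μ]
    (hcent : ∫ x, x ∂μ = 0)
    (hiso : ∀ i j : Fin n, ∫ x, x i * x j ∂μ = if i = j then 1 else 0)
    (θ : Euc n) (hθ : ‖θ‖ = 1) :
    Integrable (fun x => inner ℝ θ x) μ ∧ Integrable (fun x => inner ℝ θ x ^ 2) μ ∧
    ∫ x, inner ℝ θ x ∂μ = 0 ∧ ∫ x, inner ℝ θ x ^ 2 ∂μ = 1 := by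
  have i1 : ∀ i : Fin n, Integrable (fun x : Euc n => x i * x i) μ := by
    intro i
    apply Integrable.of_integral_ne_zero
    rw [hiso i i]; simp
  have nsq : ∀ x : Euc n, ‖x‖ ^ 2 = ∑ i, x i * x i := by
    intro x
    rw [EuclideanSpace.norm_sq_eq]
    apply Finset.sum_congr rfl
    intro i _
    rw [Real.norm_eq_abs, sq_abs, sq]
  have i2 : Integrable (fun x : Euc n => ‖x‖ ^ 2) μ := by
    simp only [nsq]
    exact integrable_finsetSum _ fun i _ => i1 i
  have i3 : Integrable (fun x : Euc n => x) μ := by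
    refine ((integrable_const (1:ℝ)).add i2).mono' (by fun_prop) (Eventually.of_forall fun x => ?_)
    simp only [Pi.add_apply]
    nlinarith [sq_nonneg (‖x‖ - 1)]
  have i4 : ∀ i j : Fin n, Integrable (fun x : Euc n => x i * x j) μ := by
    intro i j
    refine ((i1 i).add (i1 j)).mono' (by fun_prop) (Eventually.of_forall fun x => ?_)
    simp only [Pi.add_apply, Real.norm_eq_abs]
    rw [abs_le]
    constructor <;> nlinarith [sq_nonneg (x i - x j), sq_nonneg (x i + x j)]
  have e : ∀ x : Euc n, inner ℝ θ x ^ 2 = ∑ i, ∑ j, θ i * θ j * (x i * x j) := by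
    intro x
    rw [PiLp.inner_apply, sq, Finset.sum_mul_sum]
    apply Finset.sum_congr rfl; intro i _
    apply Finset.sum_congr rfl; intro j _
    simp
    ring
  refine ⟨i3.const_inner θ, ?_, ?_, ?_⟩
  · simp only [e]
    exact integrable_finsetSum _ fun i _ => integrable_finsetSum _ fun j _ => (i4 i j).const_mul _
  · rw [integral_inner i3, hcent, inner_zero_right]
  · simp only [e]
    rw [integral_finsetSum _ fun i _ => integrable_finsetSum _ fun j _ => (i4 i j).const_mul _]
    have : ∀ i : Fin n, ∫ x : Euc n, ∑ j, θ i * θ j * (x i * x j) ∂μ = θ i * θ i := by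
      intro i
      rw [integral_finsetSum _ fun j _ => (i4 i j).const_mul _]
      simp only [integral_const_mul, hiso]
      simp
    simp only [this]
    rw [← nsq, hθ]; norm_num

theorem half_ball_sub {n : ℕ} (hn : 0 < n) (f : Euc n → ℝ) (μ : Measure (Euc n))
    [IsProbabilityMeasure μ] (hfm : Measurable f) (hf : IsLogConcaveFn f)
    (hμ : μ = volume.withDensity (fun x => ENNReal.ofReal (f x)))
    (hcent : ∫ x, x ∂μ = 0)
    (hiso : ∀ i j : Fin n, ∫ x, x i * x j ∂μ = if i = j then 1 else 0) :
    ∃ M, (∀ x, f x ≤ M) ∧ ∀ x, ‖x‖ ≤ 1/2 → Real.exp (-(6 * n)) * M ≤ f x := by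
  have h1 : ∫⁻ x, ENNReal.ofReal (f x) = 1 := by
    have : μ univ = 1 := measure_univ
    rwa [hμ, withDensity_apply _ MeasurableSet.univ, Measure.restrict_univ] at this
  have hac : ∀ s : Set (Euc n), volume s = 0 → μ s = 0 := by
    intro s hs
    rw [hμ]
    exact withDensity_absolutelyContinuous _ _ hs
  obtain ⟨M0, hM0⟩ := lc_bounded f hfm hf h1
  have hbd : BddAbove (range f) := ⟨M0, by rintro _ ⟨x, rfl⟩; exact hM0 x⟩
  set M := ⨆ x, f x with hMdef
  have hfM : ∀ x, f x ≤ M := le_ciSup hbd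
  have hM : 0 < M := by
    by_contra hc
    push Not at hc
    have : ∀ x, ENNReal.ofReal (f x) = 0 := fun x => ENNReal.ofReal_eq_zero.2 ((hfM x).trans hc)
    simp [this] at h1
  obtain ⟨x0, hx0⟩ : ∃ x0, Real.exp (-(1/3)) * M < f x0 := by
    apply exists_lt_of_lt_ciSup
    have : Real.exp (-(1/3)) < 1 := by rw [Real.exp_lt_one_iff]; norm_num
    rw [← hMdef]
    nlinarith
  refine ⟨M, hfM, fun z hz => ?_⟩
  by_contra hcon
  push Not at hcon
  have mass := lc_mass hn f hfm hf h1 M hM x0 hx0.le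
  set c := Real.exp (-(6 * n)) * M with hc
  have hc0 : 0 ≤ c := by positivity
  set R : Set (Euc n) := {x | c < f x} with hR
  have hRc : Convex ℝ R := superlevel_convex hf hc0
  have hRm : MeasurableSet R := measurableSet_lt measurable_const hfm
  have hRcompl : μ Rᶜ ≤ ENNReal.ofReal 0.06 := by
    rw [hμ, withDensity_apply _ hRm.compl]
    have : Rᶜ = {x | f x ≤ c} := by ext x; simp [hR]
    rw [this]
    exact mass
  have hfr : μ (R \ interior R) = 0 := by
    apply hac
    refine measure_mono_null ?_ (hRc.addHaar_frontier volume)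
    exact sdiff_subset_sdiff_left subset_closure
  have hIc : μ (interior R)ᶜ ≤ ENNReal.ofReal 0.06 := by
    have : (interior R)ᶜ ⊆ Rᶜ ∪ (R \ interior R) := by
      intro x hx
      by_cases h : x ∈ R
      · exact Or.inr ⟨h, hx⟩
      · exact Or.inl h
    calc μ (interior R)ᶜ ≤ μ (Rᶜ ∪ (R \ interior R)) := measure_mono this
      _ ≤ μ Rᶜ + μ (R \ interior R) := measure_union_le _ _
      _ ≤ _ := by rw [hfr, add_zero]; exact hRcompl
  have hIne : (interior R).Nonempty := by
    rw [nonempty_iff_ne_empty]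
    intro h
    rw [h, compl_empty, measure_univ] at hIc
    rw [← ENNReal.ofReal_one, ENNReal.ofReal_le_ofReal_iff (by norm_num)] at hIc
    norm_num at hIc
  have hzI : z ∉ interior R := by
    intro h
    have : z ∈ R := interior_subset h
    have : c < f z := this
    linarith
  obtain ⟨φ, hφ⟩ := geometric_hahn_banach_open_point hRc.interior isOpen_interior hzI
  set w := (InnerProductSpace.toDual ℝ (Euc n)).symm φ with hw
  have hwi : ∀ x, inner ℝ w x = φ x := fun x => InnerProductSpace.toDual_symm_apply
  have hw0 : w ≠ 0 := by
    intro h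
    obtain ⟨a, ha⟩ := hIne
    have h2 := hφ a ha
    rw [← hwi, ← hwi, h] at h2
    simp at h2
  have hwn : 0 < ‖w‖ := norm_pos_iff.2 hw0
  set θ := ‖w‖⁻¹ • w with hθ
  have hθ1 : ‖θ‖ = 1 := by rw [hθ, norm_smul]; simp [hwn.ne']
  have hsep : ∀ a ∈ interior R, inner ℝ θ a < 1/2 := by
    intro a ha
    have h2 : inner ℝ θ a < inner ℝ θ z := by
      rw [hθ, real_inner_smul_left, real_inner_smul_left, hwi, hwi]
      exact mul_lt_mul_of_pos_left (hφ a ha) (by positivity)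
    have h3 := real_inner_le_norm θ z
    rw [hθ1, one_mul] at h3
    linarith
  obtain ⟨i1, i2, m1, m2⟩ := moments μ hcent hiso θ hθ1
  set X : Euc n → ℝ := fun x => inner ℝ θ x with hX
  have hXm : Measurable X := by fun_prop
  set ν := μ.map X with hν
  have : IsProbabilityMeasure ν := Measure.isProbabilityMeasure_map hXm.aemeasurable
  have hlin : ∀ (l : ℝ) (x y : Euc n), X (l • x + (1 - l) • y) = l * X x + (1 - l) * X y := by
    intro l x y
    simp only [hX, inner_add_right, real_inner_smul_right]
  have hpre : ∀ s : Set ℝ, MeasurableSet s → ν.real s = μ.real (X ⁻¹' s) := fun s hs =>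
    map_measureReal_apply hXm hs
  refine one_dim ν ?_ ?_ ?_ ?_ ?_ ?_ ?_
  · intro a b l hl0 hl1
    rw [hpre _ measurableSet_Ici, hpre _ measurableSet_Ici, hpre _ measurableSet_Ici]
    apply lc_sets f μ hfm hf hμ l hl0 hl1 _ _ _ (hXm measurableSet_Ici) (hXm measurableSet_Ici)
      (hXm measurableSet_Ici)
    intro x hx y hy
    simp only [mem_preimage, mem_Ici] at *
    rw [hlin]
    have : 0 < 1 - l := by linarith
    gcongr
  · intro a b l hl0 hl1
    rw [hpre _ measurableSet_Iic, hpre _ measurableSet_Iic, hpre _ measurableSet_Iic]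
    apply lc_sets f μ hfm hf hμ l hl0 hl1 _ _ _ (hXm measurableSet_Iic) (hXm measurableSet_Iic)
      (hXm measurableSet_Iic)
    intro x hx y hy
    simp only [mem_preimage, mem_Iic] at *
    rw [hlin]
    have : 0 < 1 - l := by linarith
    gcongr
  · exact (integrable_map_measure (by fun_prop) hXm.aemeasurable).2 i1
  · exact (integrable_map_measure (by fun_prop) hXm.aemeasurable).2 i2
  · rw [hν, integral_map hXm.aemeasurable (by fun_prop)]; exact m1
  · rw [hν, integral_map hXm.aemeasurable (by fun_prop)]; exact m2
  · rw [hpre _ measurableSet_Ici]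
    have hle : μ (X ⁻¹' Ici (1/2)) ≤ ENNReal.ofReal 0.06 := by
      refine (measure_mono ?_).trans hIc
      intro x hx hxI
      have := hsep x hxI
      simp only [mem_preimage, mem_Ici] at hx
      linarith
    exact ENNReal.toReal_le_of_le_ofReal (by norm_num) hle

/-! ### Part 6: a measurable version of the density, and conclusion -/

theorem exists_measurable_version {n : ℕ} (f : Euc n → ℝ) (hf : IsLogConcaveFn f) :
    ∃ g : Euc n → ℝ, Measurable g ∧ IsLogConcaveFn g ∧ f =ᵐ[volume] g := by
  classical
  set P : Set (Euc n) := {x | 0 < f x} with hP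
  have hPc : Convex ℝ P := superlevel_convex hf le_rfl
  set I := interior P with hI
  have hIc : Convex ℝ I := hPc.interior
  have hIP : ∀ x ∈ I, 0 < f x := fun x hx => by
    have : x ∈ P := interior_subset hx
    exact this
  have hlog : ConcaveOn ℝ I (fun x => Real.log (f x)) := by
    refine ⟨hIc, ?_⟩
    intro x hx y hy a b ha hb hab
    have hb' : b = 1 - a := by linarith
    subst hb'
    have h1 := hf.2 x y a ha (by linarith)
    have px := hIP x hx
    have py := hIP y hy
    have h2 := Real.log_le_log (by positivity) h1
    rw [Real.log_mul (by positivity) (by positivity), Real.log_rpow px, Real.log_rpow py] at h2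
    simpa using h2
  have hlc : ContinuousOn (fun x => Real.log (f x)) I := hlog.continuousOn isOpen_interior
  have hfc : ContinuousOn f I := by
    refine (hlc.rexp).congr ?_
    intro x hx
    simp only
    rw [Real.exp_log (hIP x hx)]
  have gm : Measurable (I.piecewise f (fun _ => 0)) :=
    hfc.measurable_piecewise continuousOn_const isOpen_interior.measurableSet
  have gin : ∀ x ∈ I, I.piecewise f (fun _ => 0) x = f x := fun x hx => piecewise_eq_of_mem _ _ _ hx
  have gout : ∀ x, x ∉ I → I.piecewise f (fun _ => 0) x = 0 :=
    fun x hx => piecewise_eq_of_notMem _ _ _ hx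
  set g := I.piecewise f (fun _ => 0) with hg
  have g0 : ∀ x, 0 ≤ g x := by
    intro x
    by_cases hx : x ∈ I
    · rw [gin x hx]; exact hf.1 x
    · rw [gout x hx]
  refine ⟨g, gm, ⟨g0, ?_⟩, ?_⟩
  · intro x y τ h0 h1
    rcases eq_or_lt_of_le h0 with h0' | h0'
    · subst h0'; simp
    rcases eq_or_lt_of_le h1 with h1' | h1'
    · subst h1'; simp
    by_cases hx : x ∈ I
    · by_cases hy : y ∈ I
      · rw [gin x hx, gin y hy, gin _ (hIc hx hy h0 (by linarith) (by ring))]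
        exact hf.2 x y τ h0 h1
      · rw [gout y hy, Real.zero_rpow (by linarith), mul_zero]; exact g0 _
    · rw [gout x hx, Real.zero_rpow h0'.ne', zero_mul]; exact g0 _
  · have hnull : volume (P \ I) = 0 := by
      refine measure_mono_null ?_ (hPc.addHaar_frontier volume)
      exact sdiff_subset_sdiff_left subset_closure
    filter_upwards [compl_mem_ae_iff.2 hnull] with x hx
    by_cases hxI : x ∈ I
    · rw [gin x hxI]
    · rw [gout x hxI]
      have : x ∉ P := fun h => hx ⟨h, hxI⟩
      have h2 : ¬ 0 < f x := this
      exact le_antisymm (not_lt.1 h2) (hf.1 x)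

theorem perimeter_le_of_subset_superLevelSet {n : ℕ} (f : Euc n → ℝ) (μ : Measure (Euc n))
    [IsProbabilityMeasure μ]
    (hf : IsLogConcaveFn f)
    (hμ : μ = volume.withDensity (fun x => ENNReal.ofReal (f x)))
    (hcent : ∫ x, x ∂μ = 0)
    (hiso : ∀ i j : Fin n, ∫ x, x i * x j ∂μ = if i = j then 1 else 0)
    (A : Set (Euc n)) (hA : IsConvexBody A)
    (hsub : A ⊆ superLevelSet f (6 * n)) :
    muPerim μ A ≤ 14 * (n : ℝ) ^ ((3 : ℝ) / 2) := by
  rcases Nat.eq_zero_or_pos n with hn | hn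
  · subst hn
    have hAu : A = univ := by
      obtain ⟨a, ha⟩ := hA.2.2
      ext x
      rw [Subsingleton.elim x a]
      simp [interior_subset ha]
    have : muPerim μ A = 0 := by
      simp [muPerim, hAu]
    rw [this]
    positivity
  obtain ⟨g, hgm, hg, hfg⟩ := exists_measurable_version f hf
  have hμg : μ = volume.withDensity (fun x => ENNReal.ofReal (g x)) := by
    rw [hμ]
    apply withDensity_congr_ae
    filter_upwards [hfg] with x hx
    rw [hx]
  obtain ⟨M, hM, hball⟩ := half_ball_sub hn g μ hgm hg hμg hcent hiso
  exact perim_of_ball g μ hgm hg hμg M hM hball A hA.1 hA.2.1.measurableSet hn
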